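/- Let U be a complex unitary matrix of even dimension n = 2m such that the kernel of I − U is one-dimensional, and let δ ∈ ℂ satisfy δ² = det U. Then i · δ⁻¹ · trace(adj(I − U)) is a nonzero real number. -/

import Mathlib

open Matrix in
/-- For a unitary matrix `U` of even positive size with `1 - U` singular, the adjugate of `1 - U`
is Hermitian up to the scalar `-star U.det`. -/
theorem conjTranspose_adjugate_one_sub {n : ℕ} (hn : Even n) (hn0 : n ≠ 0)
    {U : Matrix (Fin n) (Fin n) ℂ} (hU : U ∈ Matrix.unitaryGroup (Fin n) ℂ)
    (hdet : (1 - U).det = 0) :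
    (1 - U).adjugateᴴ = (-star U.det) • (1 - U).adjugate := by
  have hUU : U * Uᴴ = 1 := Matrix.mem_unitaryGroup_iff.mp hU
  have hUU' : Uᴴ * U = 1 := Matrix.mem_unitaryGroup_iff'.mp hU
  have hadj : Uᴴ.adjugate = star U.det • U := by
    calc Uᴴ.adjugate = U * Uᴴ * Uᴴ.adjugate := by rw [hUU, one_mul]
      _ = _ := by rw [mul_assoc, mul_adjugate, det_conjTranspose]; simp
  have hfix : (1 - U).adjugate * U = (1 - U).adjugate := by
    have h := adjugate_mul (1 - U)
    rw [hdet, zero_smul, mul_sub, mul_one, sub_eq_zero] at h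
    exact h.symm
  have hA : (1 - U)ᴴ = (-1 : ℂ) • (Uᴴ * (1 - U)) := by
    rw [mul_sub, hUU', mul_one, conjTranspose_sub, conjTranspose_one]
    simp
  have hodd : Odd (n - 1) := Nat.Even.sub_odd (Nat.one_le_iff_ne_zero.mpr hn0) hn odd_one
  rw [adjugate_conjTranspose, hA, adjugate_smul, adjugate_mul_distrib, hadj, Fintype.card_fin,
    hodd.neg_one_pow, mul_smul_comm, hfix, smul_smul, neg_one_mul]

open scoped ComplexOrder in
open Matrix in
/-- For a unitary matrix `U` of even size such that `1 - U` has one-dimensional kernel, the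
adjugate of `1 - U` has nonzero trace. -/
theorem trace_adjugate_one_sub_ne_zero {n : ℕ} {U : Matrix (Fin n) (Fin n) ℂ}
    (hn : Even n) (hU : U ∈ Matrix.unitaryGroup (Fin n) ℂ)
    {v : Fin n → ℂ} (hv0 : v ≠ 0) (hv : (1 - U) *ᵥ v = 0)
    (hspan : ∀ x, (1 - U) *ᵥ x = 0 → ∃ c : ℂ, c • v = x) :
    (1 - U).adjugate.trace ≠ 0 := by
  have hUU' : Uᴴ * U = 1 := Matrix.mem_unitaryGroup_iff'.mp hU
  obtain ⟨i, hi⟩ := Function.ne_iff.mp hv0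
  have hn0 : n ≠ 0 := fun h => (h ▸ i).elim0
  have hdet : (1 - U).det = 0 := exists_mulVec_eq_zero_iff.mp ⟨v, hv0, hv⟩
  have hs : star v ⬝ᵥ v ≠ 0 := fun h => hv0 (dotProduct_star_self_eq_zero.mp h)
  have hUv : U *ᵥ v = v := by
    rw [sub_mulVec, one_mulVec, sub_eq_zero] at hv
    exact hv.symm
  have hleft : star v ᵥ* (1 - U) = 0 := by
    have h : Uᴴ *ᵥ v = v := by
      conv_lhs => rw [← hUv]
      rw [mulVec_mulVec, hUU', one_mulVec]
    have h2 : star v ᵥ* U = star v := by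
      have := congrArg star h
      rwa [star_mulVec, conjTranspose_conjTranspose] at this
    rw [vecMul_sub, vecMul_one, h2, sub_self]
  have hcols : ∀ j, ∃ c : ℂ, c • v = fun k => (1 - U).adjugate k j := fun j => by
    refine hspan _ (funext fun k => ?_)
    have h := congrFun (congrFun (mul_adjugate (1 - U)) k) j
    rw [hdet, zero_smul, mul_apply] at h
    exact h
  choose w hw using hcols
  have hB : ∀ k j, (1 - U).adjugate k j = w j * v k := fun k j => (congrFun (hw j) k).symm
  have hrow : ((1 - U).updateRow i (star v)).det ≠ 0 := by
    intro h
    obtain ⟨x, hx0, hx⟩ := exists_mulVec_eq_zero_iff.mpr h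
    have hx_ne : ∀ j, j ≠ i → ((1 - U) *ᵥ x) j = 0 := fun j hj => by
      have := congrFun hx j
      simpa only [mulVec, updateRow_ne hj, Pi.zero_apply] using this
    have hvx : star v ⬝ᵥ x = 0 := by
      have := congrFun hx i
      simpa only [mulVec, updateRow_self, Pi.zero_apply] using this
    have hx_self : ((1 - U) *ᵥ x) i = 0 := by
      have h1 : star v ⬝ᵥ ((1 - U) *ᵥ x) = 0 := by
        rw [dotProduct_mulVec, hleft, zero_dotProduct]
      rw [dotProduct, Finset.sum_eq_single i (fun j _ hj => by rw [hx_ne j hj, mul_zero])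
        (by simp)] at h1
      exact (mul_eq_zero.mp h1).resolve_left (star_ne_zero.mpr hi)
    obtain ⟨c, rfl⟩ := hspan x (funext fun j => by
      by_cases hj : j = i
      · rw [hj, hx_self, Pi.zero_apply]
      · rw [hx_ne j hj, Pi.zero_apply])
    rw [dotProduct_smul, smul_eq_mul] at hvx
    exact hx0 (by rw [(mul_eq_zero.mp hvx).resolve_right hs, zero_smul])
  have hwi : w i ≠ 0 := by
    intro h
    apply hrow
    rw [← cramer_transpose_apply, cramer_eq_adjugate_mulVec, ← adjugate_transpose]
    simp [mulVec, dotProduct, hB, h]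
  have hc : -star U.det ≠ 0 := by
    refine neg_ne_zero.mpr (star_ne_zero.mpr fun h => ?_)
    have := congrArg det hUU'
    simp [h] at this
  intro htr
  have hH : ∀ j, star (w j * v i) = -star U.det * (w i * v j) := fun j => by
    have := congrFun (congrFun (conjTranspose_adjugate_one_sub hn hn0 hU hdet) j) i
    simpa only [conjTranspose_apply, Matrix.smul_apply, smul_eq_mul, hB] using this
  have hsum : star v i * star (1 - U).adjugate.trace = -star U.det * w i * (star v ⬝ᵥ v) := by
    simp only [trace, diag_apply, hB, star_sum, dotProduct, Finset.mul_sum]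
    refine Finset.sum_congr rfl fun j _ => ?_
    have := hH j
    simp only [star_mul', Pi.star_apply] at this ⊢
    linear_combination star (v j) * this
  rw [htr, star_zero, mul_zero] at hsum
  exact mul_ne_zero (mul_ne_zero hc hwi) hs hsum.symm

/-- For a unitary matrix `U` of even dimension with one-dimensional kernel of `1 - U`,
and `δ` a square root of `det U`, the number `i * δ⁻¹ * trace (adj (1 - U))` is a
nonzero real number. -/
theorem stmt6 {n : ℕ} (hn : Even n) (U : Matrix (Fin n) (Fin n) ℂ)
    (hU : U ∈ Matrix.unitaryGroup (Fin n) ℂ)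
    (hker : Module.finrank ℂ (LinearMap.ker (1 - U).mulVecLin) = 1)
    (δ : ℂ) (hδ : δ ^ 2 = U.det) :
    ∃ r : ℝ, r ≠ 0 ∧ Complex.I * δ⁻¹ * (1 - U).adjugate.trace = (r : ℂ) := by
  obtain ⟨⟨v, hv⟩, hv0, hspan⟩ := finrank_eq_one_iff'.mp hker
  have hv0' : v ≠ 0 := fun h => hv0 (Subtype.ext h)
  have hv' : (1 - U).mulVec v = 0 := hv
  have htr : (1 - U).adjugate.trace ≠ 0 :=
    trace_adjugate_one_sub_ne_zero hn hU hv0' hv' fun x hx => by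
      obtain ⟨c, hc⟩ := hspan ⟨x, hx⟩
      exact ⟨c, congrArg Subtype.val hc⟩
  obtain ⟨i, -⟩ := Function.ne_iff.mp hv0'
  have hn0 : n ≠ 0 := fun h => (h ▸ i).elim0
  have hdet : (1 - U).det = 0 := Matrix.exists_mulVec_eq_zero_iff.mp ⟨v, hv0', hv'⟩
  have hconj : star (1 - U).adjugate.trace = -star U.det * (1 - U).adjugate.trace := by
    rw [← Matrix.trace_conjTranspose, conjTranspose_adjugate_one_sub hn hn0 hU hdet,
      Matrix.trace_smul, smul_eq_mul]
  have hnorm : ‖δ‖ = 1 := by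
    have h : ‖U.det‖ = 1 := CStarRing.norm_of_mem_unitary (Matrix.det_of_mem_unitary hU)
    rw [← hδ, norm_pow] at h
    exact (pow_eq_one_iff_of_nonneg (norm_nonneg δ) two_ne_zero).mp h
  have hδ0 : δ ≠ 0 := norm_ne_zero_iff.mp (by rw [hnorm]; exact one_ne_zero)
  have hinv : δ⁻¹ = star δ := by
    rw [Complex.inv_def, Complex.normSq_eq_norm_sq, hnorm]
    simp
  have hreal : star (Complex.I * δ⁻¹ * (1 - U).adjugate.trace)
      = Complex.I * δ⁻¹ * (1 - U).adjugate.trace := by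
    have hI : star Complex.I = -Complex.I := Complex.conj_I
    have h1 : δ * star δ = 1 := by rw [← hinv, mul_inv_cancel₀ hδ0]
    rw [star_mul', star_mul', hconj, hinv, star_star, ← hδ, star_pow, hI]
    linear_combination Complex.I * star δ * (1 - U).adjugate.trace * h1
  obtain ⟨r, hr⟩ := Complex.conj_eq_iff_real.mp hreal
  refine ⟨r, ?_, hr⟩
  rintro rfl
  exact mul_ne_zero (mul_ne_zero Complex.I_ne_zero (inv_ne_zero hδ0)) htr (by simpa using hr)
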